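/- Fix a real parameter α ≥ 2. Every solution of Hill's lunar equations whose initial phase point Γ(0) satisfies E(Γ(0)) < E* and W(Γ(0)) ≤ 0 collides with the origin in finite time: its maximal time of existence T_max is finite and (x(t), y(t)) → (0,0) as t → T_max. -/

import Mathlib

open Real Set Filter Topology ENNReal

/-- r = √(x² + y²), the distance to the origin in the configuration plane. -/
noncomputable def hillR (x y : ℝ) : ℝ := Real.sqrt (x ^ 2 + y ^ 2)

/-- The effective potential V(x,y) = −((α+2)/2)x² − (α+2)/r^α. -/
noncomputable def hillV (α x y : ℝ) : ℝ :=
  -((α + 2) / 2) * x ^ 2 - (α + 2) / (hillR x y) ^ α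

/-- The partial derivative V_x. -/
noncomputable def hillVx (α x y : ℝ) : ℝ :=
  -(α + 2) * x + (α + 2) * α * x / (hillR x y) ^ (α + 2)

/-- The partial derivative V_y. -/
noncomputable def hillVy (α x y : ℝ) : ℝ :=
  (α + 2) * α * y / (hillR x y) ^ (α + 2)

/-- The energy E(Γ) = ½(ẋ² + ẏ²) + V(x,y). -/
noncomputable def hillE (α x y vx vy : ℝ) : ℝ :=
  (1 / 2) * (vx ^ 2 + vy ^ 2) + hillV α x y

/-- W(Γ) = −xV_x − yV_y = (α+2)(x² − α/r^α). -/
noncomputable def hillW (α x y : ℝ) : ℝ :=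
  (α + 2) * (x ^ 2 - α / (hillR x y) ^ α)

/-- K(Γ) = ẋ² + ẏ² + 2(xẏ − ẋy) + W(Γ). -/
noncomputable def hillK (α x y vx vy : ℝ) : ℝ :=
  vx ^ 2 + vy ^ 2 + 2 * (x * vy - vx * y) + hillW α x y

/-- The ground state energy E* = −½(α+2)²α^{−α/(α+2)}. -/
noncomputable def hillEstar (α : ℝ) : ℝ :=
  -(1 / 2) * (α + 2) ^ 2 * α ^ (-(α / (α + 2)))

/-- The time interval [0, Tmax), where Tmax ∈ (0, ∞]. -/
def hillDomain (Tmax : ℝ≥0∞) : Set ℝ := {t : ℝ | 0 ≤ t ∧ ENNReal.ofReal t < Tmax}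

/-- `HillSolOn α x y Tmax` : (x(t), y(t)) is a solution of Hill's lunar equations
ẍ − 2ẏ = −V_x, ÿ + 2ẋ = −V_y avoiding the origin on the interval [0, Tmax). -/
def HillSolOn (α : ℝ) (x y : ℝ → ℝ) (Tmax : ℝ≥0∞) : Prop :=
  ∀ t ∈ hillDomain Tmax,
    (x t, y t) ≠ (0, 0) ∧
    HasDerivAt x (deriv x t) t ∧ HasDerivAt y (deriv y t) t ∧
    HasDerivAt (deriv x) (2 * deriv y t - hillVx α (x t) (y t)) t ∧
    HasDerivAt (deriv y) (-(2 * deriv x t) - hillVy α (x t) (y t)) t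

/-- `HillMaxSol α x y Tmax` : (x(t), y(t)) is a solution of Hill's lunar equations on its
maximal interval of existence [0, Tmax): no solution on a strictly larger interval extends it. -/
def HillMaxSol (α : ℝ) (x y : ℝ → ℝ) (Tmax : ℝ≥0∞) : Prop :=
  HillSolOn α x y Tmax ∧
  ∀ T' : ℝ≥0∞, Tmax < T' →
    ¬∃ x₂ y₂ : ℝ → ℝ, HillSolOn α x₂ y₂ T' ∧
      ∀ t ∈ hillDomain Tmax, x₂ t = x t ∧ y₂ t = y t


lemma hh_key1 (α : ℝ) (hα : 2 ≤ α) (ρ : ℝ) (h0 : 0 < ρ) (h1 : ρ ≤ 1) :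
    0 ≤ 2 * (α - 2) * ρ ^ (-α) - α * (α - 2) * ρ ^ 2 - 8 * α * ρ ^ (1 - α / 2)
      + (α + 2) ^ 2 := by
  set φ : ℝ → ℝ := fun ρ => 2 * (α - 2) * ρ ^ (-α) - α * (α - 2) * ρ ^ 2
    - 8 * α * ρ ^ (1 - α / 2) + (α + 2) ^ 2 with hφ
  have hd : ∀ s : ℝ, 0 < s → HasDerivAt φ
      (-(2 * (α - 2) * α * s * (s ^ (-α / 2 - 1) - 1) ^ 2)) s := by
    intro s hs
    have e1 := (Real.hasDerivAt_rpow_const (x := s) (p := -α) (Or.inl hs.ne')).const_mul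
      (2 * (α - 2))
    have e2 := ((hasDerivAt_id s).pow 2).const_mul (α * (α - 2))
    have e3 := (Real.hasDerivAt_rpow_const (x := s) (p := 1 - α / 2) (Or.inl hs.ne')).const_mul
      (8 * α)
    have := ((e1.sub e2).sub e3).add_const ((α + 2) ^ 2)
    refine HasDerivAt.congr_deriv this ?_
    have a1 : s ^ (-α - 1) = s * (s ^ (-α / 2 - 1)) ^ 2 := by
      rw [← Real.rpow_natCast, ← Real.rpow_mul hs.le]
      nth_rw 2 [← Real.rpow_one s]
      rw [← Real.rpow_add hs]; congr 1; push_cast; ring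
    have a2 : s ^ (1 - α / 2 - 1) = s * s ^ (-α / 2 - 1) := by
      nth_rw 2 [← Real.rpow_one s]
      rw [← Real.rpow_add hs]; congr 1; ring
    rw [a1, a2]; simp; ring
  have hanti : AntitoneOn φ (Ioc 0 1) := by
    apply antitoneOn_of_hasDerivWithinAt_nonpos (convex_Ioc 0 1)
      (f' := fun s => (-(2 * (α - 2) * α * s * (s ^ (-α / 2 - 1) - 1) ^ 2)))
    · intro s hs; exact (hd s hs.1).continuousAt.continuousWithinAt
    · intro s hs; rw [interior_Ioc] at hs; exact (hd s hs.1).hasDerivWithinAt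
    · intro s hs; rw [interior_Ioc] at hs
      have : 0 < s := hs.1
      have : 0 ≤ α - 2 := by linarith
      have : 0 ≤ 2 * (α - 2) * α * s * (s ^ (-α / 2 - 1) - 1) ^ 2 := by positivity
      linarith
  have := hanti ⟨h0, h1⟩ ⟨one_pos, le_refl (1:ℝ)⟩ h1
  have h2 : φ 1 = 0 := by simp [hφ]; ring
  rw [h2] at this
  exact this

/-- basic facts about the constants -/
lemma hh_const (α : ℝ) (hα : 2 ≤ α) : ∃ rc c : ℝ, 0 < rc ∧ 0 < c ∧ c * rc ^ α = 1 ∧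
    rc ^ 2 = α * c ∧ hillEstar α = -(1 / 2) * (α + 2) ^ 2 * c := by
  have h0 : 0 < α := by linarith
  refine ⟨α ^ (1 / (α + 2)), α ^ (-(α / (α + 2))), by positivity, by positivity, ?_, ?_, rfl⟩
  · rw [← Real.rpow_mul h0.le, ← Real.rpow_add h0]
    have : -(α / (α + 2)) + 1 / (α + 2) * α = 0 := by field_simp; ring
    rw [this, Real.rpow_zero]
  · rw [← Real.rpow_natCast, ← Real.rpow_mul h0.le]
    have : α * α ^ (-(α / (α + 2))) = α ^ (1 + (-(α / (α + 2)))) := by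
      rw [Real.rpow_add h0, Real.rpow_one]
    rw [this]; congr 1; push_cast; field_simp; ring

lemma hh_Rpos {x y : ℝ} (h : (x, y) ≠ (0, 0)) : 0 < hillR x y := by
  unfold hillR
  apply Real.sqrt_pos.2
  by_contra hc
  apply h
  have h1 : x = 0 := by nlinarith [sq_nonneg x, sq_nonneg y]
  have h2 : y = 0 := by nlinarith [sq_nonneg x, sq_nonneg y]
  rw [h1, h2]

lemma hh_Rsq (x y : ℝ) : hillR x y ^ 2 = x ^ 2 + y ^ 2 := Real.sq_sqrt (by positivity)

lemma hh_W_ne (α : ℝ) (hα : 2 ≤ α) (x y vx vy : ℝ) (h : (x, y) ≠ (0, 0))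
    (hE : hillE α x y vx vy < hillEstar α) : hillW α x y ≠ 0 := by
  intro hW
  obtain ⟨rc, c, hrc, hc, h1, h2, h3⟩ := hh_const α hα
  have hr := hh_Rpos h
  have hsq := hh_Rsq x y
  rw [h3] at hE
  unfold hillE hillV at hE
  unfold hillW at hW
  set r := hillR x y
  have hp : 0 < r ^ α := by positivity
  have hx : x ^ 2 = α / r ^ α := by
    rcases mul_eq_zero.1 hW with h | h <;> linarith
  have e : (α + 2) / r ^ α = (α + 2) * (1 / r ^ α) := by ring
  have e' : α / r ^ α = α * (1 / r ^ α) := by ring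
  rw [e] at hE
  rw [e'] at hx
  have hcl : c < 1 / r ^ α := by
    rw [hx] at hE
    have : (α + 2) ^ 2 * c < (α + 2) ^ 2 * (1 / r ^ α) := by
      nlinarith [sq_nonneg vx, sq_nonneg vy]
    exact lt_of_mul_lt_mul_left this (by positivity)
  have : r ^ α < rc ^ α := by
    rw [lt_div_iff₀ hp] at hcl
    exact lt_of_mul_lt_mul_left (by linarith) hc.le
  have hrr : r < rc := by
    by_contra hcon
    push Not at hcon
    exact absurd this (not_lt.2 (Real.rpow_le_rpow hrc.le hcon (by linarith)))
  have : r ^ 2 < rc ^ 2 := by gcongr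
  have : α * c < α * (1 / r ^ α) := by gcongr
  nlinarith [sq_nonneg y]

lemma hh_K (α : ℝ) (hα : 2 ≤ α) (x y vx vy : ℝ) (h : (x, y) ≠ (0, 0))
    (hE : hillE α x y vx vy < hillEstar α) (hW : hillW α x y < 0) :
    hillK α x y vx vy ≤ 2 * (hillE α x y vx vy - hillEstar α) := by
  obtain ⟨rc, c, hrc, hc, h1, h2, h3⟩ := hh_const α hα
  have hr := hh_Rpos h
  have hsq := hh_Rsq x y
  rw [h3] at hE ⊢
  unfold hillK hillW
  unfold hillE hillV at hE ⊢
  unfold hillW at hW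
  set r := hillR x y
  have hp : 0 < r ^ α := by positivity
  have hx : x ^ 2 < α / r ^ α := by
    by_contra hcon
    push Not at hcon
    have : 0 ≤ (α + 2) * (x ^ 2 - α / r ^ α) := by
      apply mul_nonneg <;> linarith
    linarith
  have e : (α + 2) / r ^ α = (α + 2) * (1 / r ^ α) := by ring
  have e' : α / r ^ α = α * (1 / r ^ α) := by ring
  rw [e] at hE ⊢
  rw [e'] at hx ⊢
  have hcl : c < 1 / r ^ α := by
    have : (α + 2) ^ 2 * c < (α + 2) ^ 2 * (1 / r ^ α) := by
      have := mul_lt_mul_of_pos_left hx (show 0 < α + 2 by linarith)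
      linarith [sq_nonneg vx, sq_nonneg vy]
    exact lt_of_mul_lt_mul_left this (by positivity)
  have hlt : r ^ α < rc ^ α := by
    rw [lt_div_iff₀ hp] at hcl
    exact lt_of_mul_lt_mul_left (by linarith) hc.le
  have hrr : r < rc := by
    by_contra hcon
    push Not at hcon
    exact absurd hlt (not_lt.2 (Real.rpow_le_rpow hrc.le hcon (by linarith)))
  obtain ⟨ρ, hρ⟩ : ∃ ρ, ρ = r / rc := ⟨_, rfl⟩
  have hρ0 : 0 < ρ := by rw [hρ]; positivity
  have hρ1 : ρ ≤ 1 := by rw [hρ, div_le_one hrc]; exact hrr.le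
  have k1 := hh_key1 α hα ρ hρ0 hρ1
  have hu1 : 1 ≤ ρ ^ (-α) := Real.one_le_rpow_of_pos_of_le_one_of_nonpos hρ0 hρ1 (by linarith)
  have hw1 : 1 ≤ ρ ^ (1 - α / 2) :=
    Real.one_le_rpow_of_pos_of_le_one_of_nonpos hρ0 hρ1 (by linarith)
  have hwuv : (ρ ^ (1 - α / 2)) ^ 2 = ρ ^ (-α) * ρ ^ 2 := by
    rw [← Real.rpow_natCast, ← Real.rpow_mul hρ0.le, ← Real.rpow_natCast,
      ← Real.rpow_add hρ0]; congr 1; push_cast; ring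
  have hv1 : ρ ^ 2 ≤ 1 := pow_le_one₀ hρ0.le hρ1
  have hv0 : 0 < ρ ^ 2 := by positivity
  have hu : 1 / r ^ α = c * ρ ^ (-α) := by
    rw [hρ, Real.rpow_neg (by positivity), Real.div_rpow hr.le hrc.le]
    field_simp
    linarith
  have hv : r ^ 2 = α * c * ρ ^ 2 := by
    rw [← h2, hρ]; field_simp
  generalize ρ ^ (-α) = u at *
  generalize ρ ^ (1 - α / 2) = w at *
  generalize ρ ^ 2 = v at *
  rw [hu] at hE hx ⊢
  have hxr : x ^ 2 ≤ α * c * v := by linarith [sq_nonneg y]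
  have ha : 0 < α := by linarith
  have k2 : -(α + 2) ^ 2 + 2 * α ^ 2 * v - (α - 2) * (α + 2) * u + 4 * α * w ≤ 0 := by
    have q1 : 0 ≤ (2 * α ^ 2 - α * (α - 2) / 2) * (1 - v) :=
      mul_nonneg (by linarith [sq_nonneg α]) (by linarith)
    have q2 : 0 ≤ (α - 2) * (α + 1) * (u - 1) := by
      apply mul_nonneg (mul_nonneg _ _) <;> linarith
    linarith
  -- speed bound
  have hs : vx ^ 2 + vy ^ 2 ≤ c * (4 * α * (u - 2 * w + v)) := by
    have q1 : vx ^ 2 + vy ^ 2 ≤ c * (-(α + 2) ^ 2 + (α + 2) * α * v + 2 * (α + 2) * u) := by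
      have : (α + 2) * x ^ 2 ≤ (α + 2) * (α * c * v) := by gcongr
      linarith
    refine q1.trans ?_
    gcongr
    linarith
  have hl2 : (x * vy - vx * y) ^ 2 ≤ (2 * α * c * (w - v)) ^ 2 := by
    calc (x * vy - vx * y) ^ 2 ≤ (x ^ 2 + y ^ 2) * (vx ^ 2 + vy ^ 2) := by
          linarith [sq_nonneg (x * vx + y * vy)]
      _ ≤ (α * c * v) * (c * (4 * α * (u - 2 * w + v))) := by
          rw [← hsq, hv]; gcongr
      _ = (2 * α * c) ^ 2 * (u * v - 2 * w * v + v ^ 2) := by ring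
      _ = _ := by rw [← hwuv]; ring
  have hl : x * vy - vx * y ≤ 2 * α * c * (w - v) := by
    apply le_of_sq_le_sq hl2
    have : 0 ≤ w - v := by linarith
    positivity
  have q3 : (α + 2) * x ^ 2 ≤ (α + 2) * (α * c * v) := by gcongr
  have q4 := mul_nonpos_of_nonneg_of_nonpos hc.le k2
  linarith

noncomputable def hhGlue (T : ℝ) (f g : ℝ → ℝ) : ℝ → ℝ := fun t => if t < T then f t else g t

lemma hhGlue_lt (T : ℝ) (f g : ℝ → ℝ) {t : ℝ} (h : t < T) : hhGlue T f g t = f t := by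
  simp [hhGlue, h]

lemma hhGlue_ge (T : ℝ) (f g : ℝ → ℝ) {t : ℝ} (h : T ≤ t) : hhGlue T f g t = g t := by
  simp [hhGlue, not_lt.2 h]

lemma hhGlue_ev_lt (T : ℝ) (f g : ℝ → ℝ) {t : ℝ} (h : t < T) : hhGlue T f g =ᶠ[𝓝 t] f := by
  filter_upwards [Iio_mem_nhds h] with s hs using hhGlue_lt T f g hs

lemma hh_glue_deriv (T ε : ℝ) (hT : 0 < T) (hε : 0 < ε) (f f' g g' : ℝ → ℝ)
    (hf : ∀ t ∈ Ioo 0 T, HasDerivAt f (f' t) t)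
    (hg : ∀ t ∈ Ioo (T - ε) (T + ε), HasDerivAt g (g' t) t)
    (hl : Tendsto f (𝓝[<] T) (𝓝 (g T))) (hl' : Tendsto f' (𝓝[<] T) (𝓝 (g' T))) :
    ∀ t ∈ Ioo 0 (T + ε), HasDerivAt (hhGlue T f g) (hhGlue T f' g' t) t := by
  intro t ht
  rcases lt_trichotomy t T with h | h | h
  · rw [hhGlue_lt _ _ _ h]
    exact (hf t ⟨ht.1, h⟩).congr_of_eventuallyEq (hhGlue_ev_lt T f g h)
  · subst h
    rw [hhGlue_ge _ _ _ le_rfl]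
    have hmem : Ioo 0 t ∈ 𝓝[<] t := Ioo_mem_nhdsLT hT
    have hL : HasDerivWithinAt (hhGlue t f g) (g' t) (Iic t) t := by
      apply hasDerivWithinAt_Iic_of_tendsto_deriv (s := Ioo 0 t) _ _ hmem
      · refine hl'.congr' ?_
        filter_upwards [hmem] with s hs
        rw [(hhGlue_ev_lt t f g hs.2).deriv_eq, (hf s hs).deriv]
      · intro s hs
        exact ((hf s hs).congr_of_eventuallyEq
          (hhGlue_ev_lt t f g hs.2)).differentiableAt.differentiableWithinAt
      · unfold ContinuousWithinAt
        rw [hhGlue_ge _ _ _ le_rfl]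
        have : 𝓝[Ioo 0 t] t ≤ 𝓝[<] t := nhdsWithin_mono _ (fun s hs => hs.2)
        refine (hl.mono_left this).congr' ?_
        filter_upwards [self_mem_nhdsWithin] with s hs
        rw [hhGlue_lt _ _ _ hs.2]
    have hR : HasDerivWithinAt (hhGlue t f g) (g' t) (Ici t) t := by
      apply (hg t ⟨by linarith, by linarith⟩).hasDerivWithinAt.congr
      · intro s hs; exact hhGlue_ge _ _ _ hs
      · exact hhGlue_ge _ _ _ le_rfl
    have := hL.union hR
    rwa [Iic_union_Ici, hasDerivWithinAt_univ] at this
  · rw [hhGlue_ge _ _ _ h.le]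
    apply (hg t ⟨by linarith, ht.2⟩).congr_of_eventuallyEq
    filter_upwards [Ioi_mem_nhds h] with s hs using hhGlue_ge T f g (le_of_lt hs)

noncomputable def hhF (α : ℝ) (z : ℝ × ℝ × ℝ × ℝ) : ℝ × ℝ × ℝ × ℝ :=
  (z.2.2.1, z.2.2.2, 2 * z.2.2.2 - hillVx α z.1 z.2.1, -(2 * z.2.2.1) - hillVy α z.1 z.2.1)

lemma hhF_smooth (α : ℝ) (z : ℝ × ℝ × ℝ × ℝ) (h : (z.1, z.2.1) ≠ (0, 0)) :
    ContDiffAt ℝ 1 (hhF α) z := by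
  have hr := hh_Rpos h
  have hR : ContDiffAt ℝ 1 (fun z : ℝ × ℝ × ℝ × ℝ => hillR z.1 z.2.1) z := by
    unfold hillR
    apply ContDiffAt.sqrt
    · fun_prop
    · have := hh_Rsq z.1 z.2.1
      rw [← this]; positivity
  have hP : ContDiffAt ℝ 1 (fun z : ℝ × ℝ × ℝ × ℝ => (hillR z.1 z.2.1) ^ (α + 2)) z :=
    hR.rpow_const_of_ne hr.ne'
  have hne : (hillR z.1 z.2.1) ^ (α + 2) ≠ 0 := by positivity
  have hX : ContDiffAt ℝ 1 (fun z : ℝ × ℝ × ℝ × ℝ => hillVx α z.1 z.2.1) z := by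
    unfold hillVx
    refine ContDiffAt.add (by fun_prop) (ContDiffAt.div (by fun_prop) hP hne)
  have hY : ContDiffAt ℝ 1 (fun z : ℝ × ℝ × ℝ × ℝ => hillVy α z.1 z.2.1) z := by
    unfold hillVy
    exact (ContDiffAt.div (by fun_prop) hP hne)
  unfold hhF
  refine ContDiffAt.prodMk (by fun_prop) (ContDiffAt.prodMk (by fun_prop)
    (ContDiffAt.prodMk ?_ ?_))
  · exact ContDiffAt.sub (by fun_prop) hX
  · exact ContDiffAt.sub (by fun_prop) hY

lemma hh_dom {T t : ℝ} (hT : 0 < T) : t ∈ hillDomain (ENNReal.ofReal T) ↔ 0 ≤ t ∧ t < T := by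
  unfold hillDomain
  change (0 ≤ t ∧ _ < _) ↔ _
  rw [ENNReal.ofReal_lt_ofReal_iff hT]

lemma hh_extend (α T : ℝ) (hT : 0 < T) (x y : ℝ → ℝ) (h : HillSolOn α x y (ENNReal.ofReal T))
    (a b c d : ℝ) (hab : (a, b) ≠ (0, 0)) (hx : Tendsto x (𝓝[<] T) (𝓝 a))
    (hy : Tendsto y (𝓝[<] T) (𝓝 b)) (hvx : Tendsto (deriv x) (𝓝[<] T) (𝓝 c))
    (hvy : Tendsto (deriv y) (𝓝[<] T) (𝓝 d)) :
    ∃ T' : ℝ≥0∞, ENNReal.ofReal T < T' ∧ ∃ x₂ y₂ : ℝ → ℝ, HillSolOn α x₂ y₂ T' ∧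
      ∀ t ∈ hillDomain (ENNReal.ofReal T), x₂ t = x t ∧ y₂ t = y t := by
  have hsm := hhF_smooth α (a, b, c, d) hab
  obtain ⟨γ, hγ0, ε, hε, hγ⟩ :=
    hsm.exists_forall_mem_closedBall_exists_eq_forall_mem_Ioo_hasDerivAt₀ T
  have hc : ContinuousAt γ T := (hγ T ⟨by linarith, by linarith⟩).continuousAt
  have hne : ∀ᶠ t in 𝓝 T, ((γ t).1, (γ t).2.1) ≠ (0, 0) := by
    have hc2 : ContinuousAt (fun t => ((γ t).1, (γ t).2.1)) T :=
      hc.fst.prodMk hc.snd.fst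
    apply hc2.eventually_ne
    rw [hγ0]; exact hab
  obtain ⟨δ', hδ', hδne⟩ := Metric.eventually_nhds_iff.1 hne
  obtain ⟨δ, hδ, hδε, hδδ'⟩ : ∃ δ > 0, δ ≤ ε ∧ δ ≤ δ' :=
    ⟨min ε δ', lt_min hε hδ', min_le_left _ _, min_le_right _ _⟩
  have hγ' : ∀ t ∈ Ioo (T - δ) (T + δ), HasDerivAt γ (hhF α (γ t)) t := fun t ht =>
    hγ t ⟨by linarith [ht.1], by linarith [ht.2]⟩
  have g1 : ∀ t ∈ Ioo (T - δ) (T + δ), HasDerivAt (fun t => (γ t).1) ((γ t).2.2.1) t :=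
    fun t ht => (hγ' t ht).fst
  have g2 : ∀ t ∈ Ioo (T - δ) (T + δ), HasDerivAt (fun t => (γ t).2.1) ((γ t).2.2.2) t :=
    fun t ht => (hγ' t ht).snd.fst
  have g3 : ∀ t ∈ Ioo (T - δ) (T + δ), HasDerivAt (fun t => (γ t).2.2.1)
      (2 * (γ t).2.2.2 - hillVx α (γ t).1 (γ t).2.1) t :=
    fun t ht => (hγ' t ht).snd.snd.fst
  have g4 : ∀ t ∈ Ioo (T - δ) (T + δ), HasDerivAt (fun t => (γ t).2.2.2)
      (-(2 * (γ t).2.2.1) - hillVy α (γ t).1 (γ t).2.1) t :=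
    fun t ht => (hγ' t ht).snd.snd.snd
  have hs : ∀ t ∈ Ioo 0 T, _ := fun t ht => h t ((hh_dom hT).2 ⟨ht.1.le, ht.2⟩)
  have hlim : Tendsto (fun t => hhF α (x t, y t, deriv x t, deriv y t)) (𝓝[<] T)
      (𝓝 (hhF α (a, b, c, d))) :=
    hsm.continuousAt.tendsto.comp
      (hx.prodMk_nhds (hy.prodMk_nhds (hvx.prodMk_nhds hvy)))
  have k1 := hh_glue_deriv T δ hT hδ x (deriv x) _ _ (fun t ht => (hs t ht).2.1) g1
    (by rw [hγ0]; exact hx) (by rw [hγ0]; exact hvx)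
  have k2 := hh_glue_deriv T δ hT hδ y (deriv y) _ _ (fun t ht => (hs t ht).2.2.1) g2
    (by rw [hγ0]; exact hy) (by rw [hγ0]; exact hvy)
  have k3 := hh_glue_deriv T δ hT hδ (deriv x) _ _ _ (fun t ht => (hs t ht).2.2.2.1) g3
    (by rw [hγ0]; exact hvx)
    (by rw [hγ0]; exact ((continuous_fst.comp (continuous_snd.comp continuous_snd)).tendsto
          _).comp hlim)
  have k4 := hh_glue_deriv T δ hT hδ (deriv y) _ _ _ (fun t ht => (hs t ht).2.2.2.2) g4
    (by rw [hγ0]; exact hvy)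
    (by rw [hγ0]; exact ((continuous_snd.comp (continuous_snd.comp continuous_snd)).tendsto
          _).comp hlim)
  set x₂ := hhGlue T x (fun t => (γ t).1) with hx2
  set y₂ := hhGlue T y (fun t => (γ t).2.1) with hy2
  refine ⟨ENNReal.ofReal (T + δ), ?_, x₂, y₂, ?_, ?_⟩
  · rw [ENNReal.ofReal_lt_ofReal_iff (by linarith)]; linarith
  · intro t ht
    rw [hh_dom (by linarith)] at ht
    by_cases hlt : t < T
    · have e1 : x₂ =ᶠ[𝓝 t] x := hhGlue_ev_lt _ _ _ hlt
      have e2 : y₂ =ᶠ[𝓝 t] y := hhGlue_ev_lt _ _ _ hlt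
      obtain ⟨p1, p2, p3, p4, p5⟩ := h t ((hh_dom hT).2 ⟨ht.1, hlt⟩)
      rw [e1.eq_of_nhds, e2.eq_of_nhds, e1.deriv_eq, e2.deriv_eq]
      exact ⟨p1, p2.congr_of_eventuallyEq e1, p3.congr_of_eventuallyEq e2,
        p4.congr_of_eventuallyEq e1.deriv, p5.congr_of_eventuallyEq e2.deriv⟩
    · push Not at hlt
      have hI : t ∈ Ioo 0 (T + δ) := ⟨by linarith, ht.2⟩
      have e1 : deriv x₂ =ᶠ[𝓝 t] hhGlue T (deriv x) (fun t => (γ t).2.2.1) := by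
        filter_upwards [Ioo_mem_nhds hI.1 hI.2] with s hs using (k1 s hs).deriv
      have e2 : deriv y₂ =ᶠ[𝓝 t] hhGlue T (deriv y) (fun t => (γ t).2.2.2) := by
        filter_upwards [Ioo_mem_nhds hI.1 hI.2] with s hs using (k2 s hs).deriv
      have q1 := k1 t hI
      have q2 := k2 t hI
      have q3 := (k3 t hI).congr_of_eventuallyEq e1
      have q4 := (k4 t hI).congr_of_eventuallyEq e2
      have d1 := e1.eq_of_nhds
      have d2 := e2.eq_of_nhds
      have v1 : x₂ t = (γ t).1 := hhGlue_ge _ _ _ hlt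
      have v2 : y₂ t = (γ t).2.1 := hhGlue_ge _ _ _ hlt
      rw [hhGlue_ge _ _ _ hlt] at q1 q2 q3 q4 d1 d2
      rw [v1, v2, d1, d2]
      refine ⟨hδne ?_, q1, q2, q3, q4⟩
      rw [Real.dist_eq, abs_of_nonneg (by linarith)]; linarith
  · intro t ht
    rw [hh_dom hT] at ht
    exact ⟨hhGlue_lt _ _ _ ht.2, hhGlue_lt _ _ _ ht.2⟩

lemma hh_lim (T C : ℝ) (f f' : ℝ → ℝ) (hf : ∀ᶠ t in 𝓝[<] T, HasDerivAt f (f' t) t)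
    (hb : ∀ᶠ t in 𝓝[<] T, |f' t| ≤ C) : ∃ l, Tendsto f (𝓝[<] T) (𝓝 l) := by
  obtain ⟨a, ha, hs⟩ := (mem_nhdsLT_iff_exists_Ioo_subset).1 (hf.and hb)
  have hC : LipschitzOnWith C.toNNReal f (Ioo a T) := by
    apply (convex_Ioo a T).lipschitzOnWith_of_nnnorm_hasDerivWithin_le
      (fun t ht => (hs ht).1.hasDerivWithinAt)
    intro t ht
    have := (hs ht).2
    rw [← NNReal.coe_le_coe, coe_nnnorm, Real.norm_eq_abs]
    exact this.trans (Real.le_coe_toNNReal C)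
  obtain ⟨g, hg, he⟩ := hC.extend_real
  refine ⟨g T, (hg.continuous.continuousAt.tendsto.mono_left nhdsWithin_le_nhds).congr' ?_⟩
  filter_upwards [Ioo_mem_nhdsLT ha] with t ht using (he ht).symm

lemma hh_derivP (α : ℝ) (x y : ℝ → ℝ) (t vx vy : ℝ) (h : (x t, y t) ≠ (0, 0))
    (hx : HasDerivAt x vx t) (hy : HasDerivAt y vy t) :
    HasDerivAt (fun t => 1 / (hillR (x t) (y t)) ^ α)
      (-(α * (x t * vx + y t * vy) / (hillR (x t) (y t)) ^ (α + 2))) t := by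
  have hr := hh_Rpos h
  have hq : HasDerivAt (fun t => x t ^ 2 + y t ^ 2) (2 * x t * vx + 2 * y t * vy) t := by
    refine ((hx.pow 2).add (hy.pow 2)).congr_deriv ?_
    simp
  have hR : HasDerivAt (fun t => hillR (x t) (y t))
      ((2 * x t * vx + 2 * y t * vy) / (2 * hillR (x t) (y t))) t :=
    hq.sqrt (by rw [← hh_Rsq]; positivity)
  have hP := hR.rpow_const (p := -α) (Or.inl hr.ne')
  have e : (fun t => 1 / (hillR (x t) (y t)) ^ α) = fun t => (hillR (x t) (y t)) ^ (-α) := by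
    funext s
    rw [Real.rpow_neg (show 0 ≤ hillR (x s) (y s) from Real.sqrt_nonneg _), one_div]
  rw [e]
  refine hP.congr_deriv ?_
  have : hillR (x t) (y t) ^ (-α - 1) = hillR (x t) (y t) / hillR (x t) (y t) ^ (α + 2) := by
    rw [_root_.eq_div_iff (by positivity), ← Real.rpow_add hr]
    ring_nf
    rw [Real.rpow_one]
  rw [this]
  field_simp

lemma hh_derivE (α : ℝ) (x y : ℝ → ℝ) (t : ℝ) (h : (x t, y t) ≠ (0, 0))
    (hx : HasDerivAt x (deriv x t) t) (hy : HasDerivAt y (deriv y t) t)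
    (hvx : HasDerivAt (deriv x) (2 * deriv y t - hillVx α (x t) (y t)) t)
    (hvy : HasDerivAt (deriv y) (-(2 * deriv x t) - hillVy α (x t) (y t)) t) :
    HasDerivAt (fun t => hillE α (x t) (y t) (deriv x t) (deriv y t)) 0 t := by
  have hP := hh_derivP α x y t _ _ h hx hy
  have h1 := (((hvx.pow 2).add (hvy.pow 2)).const_mul (1 / 2 : ℝ)).add
    (((hx.pow 2).const_mul (-((α + 2) / 2))).sub (hP.const_mul (α + 2)))
  have e : (fun t => hillE α (x t) (y t) (deriv x t) (deriv y t)) = fun t =>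
      (1 / 2) * (deriv x t ^ 2 + deriv y t ^ 2) + (-((α + 2) / 2) * x t ^ 2
        - (α + 2) * (1 / hillR (x t) (y t) ^ α)) := by
    funext s; unfold hillE hillV; ring
  rw [e]
  refine HasDerivAt.congr_deriv h1 ?_
  unfold hillVx hillVy
  simp
  ring

lemma hh_derivJ (α : ℝ) (x y : ℝ → ℝ) (t : ℝ) (h : (x t, y t) ≠ (0, 0))
    (hx : HasDerivAt x (deriv x t) t) (hy : HasDerivAt y (deriv y t) t)
    (hvx : HasDerivAt (deriv x) (2 * deriv y t - hillVx α (x t) (y t)) t)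
    (hvy : HasDerivAt (deriv y) (-(2 * deriv x t) - hillVy α (x t) (y t)) t) :
    HasDerivAt (fun t => x t * deriv x t + y t * deriv y t)
      (hillK α (x t) (y t) (deriv x t) (deriv y t)) t := by
  refine ((hx.mul hvx).add (hy.mul hvy)).congr_deriv ?_
  have hr := hh_Rpos h
  have hsq := hh_Rsq (x t) (y t)
  unfold hillVx hillVy hillK hillW
  set r := hillR (x t) (y t)
  have h2 : r ^ (α + 2) = r ^ α * (x t ^ 2 + y t ^ 2) := by
    rw [Real.rpow_add hr, ← hsq]; norm_num
  rw [h2]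
  have h3 : x t ^ 2 + y t ^ 2 ≠ 0 := by rw [← hsq]; positivity
  have h4 : r ^ α ≠ 0 := by positivity
  have h5 : α / r ^ α = (x t ^ 2 + y t ^ 2) * α / (r ^ α * (x t ^ 2 + y t ^ 2)) := by
    field_simp
  rw [h5]
  ring

lemma hh_domConvex (T : ℝ≥0∞) : Convex ℝ (hillDomain T) := by
  apply OrdConnected.convex
  constructor
  intro a ha b hb c hc
  exact ⟨ha.1.trans hc.1, lt_of_le_of_lt (ENNReal.ofReal_le_ofReal hc.2) hb.2⟩

lemma hh_anti (D : Set ℝ) (hD : Convex ℝ D) (f f' : ℝ → ℝ)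
    (h : ∀ t ∈ D, HasDerivAt f (f' t) t) (h0 : ∀ t ∈ D, f' t ≤ 0) : AntitoneOn f D :=
  antitoneOn_of_hasDerivWithinAt_nonpos hD
    (fun t ht => (h t ht).continuousAt.continuousWithinAt)
    (fun t ht => (h t (interior_subset ht)).hasDerivWithinAt)
    (fun t ht => h0 t (interior_subset ht))

/-- a priori information along the flow -/
lemma hh_apriori (α : ℝ) (hα : 2 ≤ α) (Tmax : ℝ≥0∞) (hT : 0 < Tmax) (x y : ℝ → ℝ)
    (hsol : HillSolOn α x y Tmax)
    (hE : hillE α (x 0) (y 0) (deriv x 0) (deriv y 0) < hillEstar α)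
    (hW : hillW α (x 0) (y 0) ≤ 0) :
    ∀ t ∈ hillDomain Tmax, hillE α (x t) (y t) (deriv x t) (deriv y t)
        = hillE α (x 0) (y 0) (deriv x 0) (deriv y 0) ∧
      hillK α (x t) (y t) (deriv x t) (deriv y t)
        ≤ 2 * (hillE α (x 0) (y 0) (deriv x 0) (deriv y 0) - hillEstar α) := by
  have h0 : (0 : ℝ) ∈ hillDomain Tmax := ⟨le_rfl, by simpa using hT⟩
  have hD := hh_domConvex Tmax
  have hEd : ∀ t ∈ hillDomain Tmax, _ := fun t ht =>
    hh_derivE α x y t (hsol t ht).1 (hsol t ht).2.1 (hsol t ht).2.2.1 (hsol t ht).2.2.2.1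
      (hsol t ht).2.2.2.2
  have hEc : ∀ t ∈ hillDomain Tmax, hillE α (x t) (y t) (deriv x t) (deriv y t)
        = hillE α (x 0) (y 0) (deriv x 0) (deriv y 0) := by
    intro t ht
    have a1 := hh_anti _ hD _ (fun _ => 0) hEd (fun _ _ => le_rfl) h0 ht ht.1
    have a2 := hh_anti _ hD _ (fun _ => -0) (fun t ht => (hEd t ht).neg)
      (fun _ _ => by simp) h0 ht ht.1
    simp only [Pi.neg_apply] at a1 a2
    linarith
  have hWne : ∀ t ∈ hillDomain Tmax, hillW α (x t) (y t) ≠ 0 := fun t ht =>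
    hh_W_ne α hα _ _ (deriv x t) (deriv y t) (hsol t ht).1 (by rw [hEc t ht]; exact hE)
  have hWc : ContinuousOn (fun t => hillW α (x t) (y t)) (hillDomain Tmax) := by
    intro t ht
    apply ContinuousAt.continuousWithinAt
    have hP := (hh_derivP α x y t _ _ (hsol t ht).1 (hsol t ht).2.1
      (hsol t ht).2.2.1).continuousAt
    have e : (fun t => hillW α (x t) (y t)) = fun t =>
        (α + 2) * (x t ^ 2 - α * (1 / hillR (x t) (y t) ^ α)) := by
      funext s; unfold hillW; ring
    rw [e]
    exact continuousAt_const.mul (((hsol t ht).2.1.continuousAt.pow 2).sub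
      (continuousAt_const.mul hP))
  have hWneg : ∀ t ∈ hillDomain Tmax, hillW α (x t) (y t) < 0 := by
    intro t ht
    by_contra hcon
    push Not at hcon
    obtain ⟨s, hs, hs0⟩ := hD.isPreconnected.intermediate_value h0 ht hWc ⟨hW, hcon⟩
    exact hWne s hs hs0
  intro t ht
  refine ⟨hEc t ht, ?_⟩
  rw [← hEc t ht]
  exact hh_K α hα _ _ _ _ (hsol t ht).1 (by rw [hEc t ht]; exact hE) (hWneg t ht)

lemma hh_Imono (α : ℝ) (Tmax : ℝ≥0∞) (hT : 0 < Tmax) (x y : ℝ → ℝ)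
    (hsol : HillSolOn α x y Tmax) (k : ℝ)
    (hK : ∀ t ∈ hillDomain Tmax, hillK α (x t) (y t) (deriv x t) (deriv y t) ≤ -k) :
    ∃ j : ℝ, AntitoneOn (fun t => (x t ^ 2 + y t ^ 2) - 2 * j * t + k * t ^ 2)
      (hillDomain Tmax) := by
  have h0 : (0 : ℝ) ∈ hillDomain Tmax := ⟨le_rfl, by simpa using hT⟩
  have hD := hh_domConvex Tmax
  have hJd : ∀ t ∈ hillDomain Tmax, _ := fun t ht =>
    hh_derivJ α x y t (hsol t ht).1 (hsol t ht).2.1 (hsol t ht).2.2.1 (hsol t ht).2.2.2.1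
      (hsol t ht).2.2.2.2
  refine ⟨x 0 * deriv x 0 + y 0 * deriv y 0, ?_⟩
  have hJ : ∀ t ∈ hillDomain Tmax, x t * deriv x t + y t * deriv y t + k * t ≤
      x 0 * deriv x 0 + y 0 * deriv y 0 := by
    intro t ht
    have := hh_anti _ hD (fun t => x t * deriv x t + y t * deriv y t + k * t) _
      (fun t ht => (hJd t ht).add ((hasDerivAt_id t).const_mul k))
      (fun t ht => by have := hK t ht; linarith) h0 ht ht.1
    simpa using this
  apply hh_anti _ hD _ (fun t => 2 * x t * deriv x t + 2 * y t * deriv y t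
    - 2 * (x 0 * deriv x 0 + y 0 * deriv y 0) + 2 * k * t)
  · intro t ht
    refine (((((hsol t ht).2.1.pow 2).add ((hsol t ht).2.2.1.pow 2)).sub
      ((hasDerivAt_id t).const_mul _)).add (((hasDerivAt_id t).pow 2).const_mul k)).congr_deriv ?_
    simp
    ring
  · intro t ht
    have := hJ t ht
    linarith

/-- for α ≥ 2, solutions starting in 𝒲₋ = {E < E*, W ≤ 0} collide with the
origin in finite time. -/
theorem hill_below_ground_state_collision
    (α : ℝ) (hα : 2 ≤ α) (Tmax : ℝ≥0∞) (hT : 0 < Tmax) (x y : ℝ → ℝ)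
    (hsol : HillMaxSol α x y Tmax)
    (hE : hillE α (x 0) (y 0) (deriv x 0) (deriv y 0) < hillEstar α)
    (hW : hillW α (x 0) (y 0) ≤ 0) :
    Tmax ≠ ⊤ ∧
      Tendsto (fun t => (x t, y t)) (𝓝[<] Tmax.toReal) (𝓝 ((0 : ℝ), (0 : ℝ))) := by
  obtain ⟨hsol, hmax⟩ := hsol
  have hap := hh_apriori α hα Tmax hT x y hsol hE hW
  obtain ⟨k, hk⟩ : ∃ k, k = -(2 * (hillE α (x 0) (y 0) (deriv x 0) (deriv y 0)
    - hillEstar α)) := ⟨_, rfl⟩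
  have hk0 : 0 < k := by rw [hk]; linarith
  obtain ⟨j, hj⟩ := hh_Imono α Tmax hT x y hsol k
    (fun t ht => by rw [hk, neg_neg]; exact (hap t ht).2)
  have h0 : (0 : ℝ) ∈ hillDomain Tmax := ⟨le_rfl, by simpa using hT⟩
  have hfin : Tmax ≠ ⊤ := by
    intro htop
    subst htop
    set q := x 0 ^ 2 + y 0 ^ 2
    have hq : 0 ≤ q := by positivity
    set t : ℝ := (2 * |j| + q + 1) / k + 1 with ht
    have hpos : 1 ≤ t := by rw [ht]; have : 0 ≤ (2 * |j| + q + 1) / k := by positivity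
                            linarith
    have := hj h0 (b := t) ⟨by linarith, by simp⟩ (by linarith)
    simp only at this
    have hkt : k * t = 2 * |j| + q + 1 + k := by rw [ht]; field_simp
    have : k * t ^ 2 = (2 * |j| + q + 1 + k) * t := by rw [← hkt]; ring
    have : j * t ≤ |j| * t := by gcongr; exact le_abs_self j
    have : q * 1 ≤ q * t := by gcongr
    have : 0 < k * t := by positivity
    nlinarith [sq_nonneg (x t), sq_nonneg (y t)]
  refine ⟨hfin, ?_⟩
  obtain ⟨T, hTT⟩ : ∃ T, T = Tmax.toReal := ⟨_, rfl⟩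
  have hTo : Tmax = ENNReal.ofReal T := by rw [hTT, ENNReal.ofReal_toReal hfin]
  rw [← hTT]
  have hTp : 0 < T := by rw [hTT]; exact ENNReal.toReal_pos hT.ne' hfin
  clear hTT
  subst hTo
  -- the limit of r ^ 2
  have hIoo : ∀ t ∈ Ioo 0 T, t ∈ hillDomain (ENNReal.ofReal T) := fun t ht =>
    (hh_dom hTp).2 ⟨ht.1.le, ht.2⟩
  have hev : ∀ᶠ t in 𝓝[<] T, t ∈ hillDomain (ENNReal.ofReal T) := by
    filter_upwards [Ioo_mem_nhdsLT hTp] with t ht using hIoo t ht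
  obtain ⟨L, hL⟩ : ∃ L, Tendsto (fun t => x t ^ 2 + y t ^ 2) (𝓝[<] T) (𝓝 L) := by
    have h1 := AntitoneOn.tendsto_nhdsWithin_Ioo_left (nonempty_Ioo.2 hTp)
      (hj.mono hIoo) ⟨-(2 * |j| * T), by
        rintro _ ⟨t, ht, rfl⟩
        have : j * t ≤ |j| * T := by
          have a1 : j * t ≤ |j| * t := by gcongr; exacts [ht.1.le, le_abs_self j]
          have a2 : |j| * t ≤ |j| * T := by gcongr; exact ht.2.le
          linarith
        have : 0 ≤ k * t ^ 2 := by positivity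
        nlinarith [sq_nonneg (x t), sq_nonneg (y t)]⟩
    have h2 : Tendsto (fun t : ℝ => 2 * j * t - k * t ^ 2) (𝓝[<] T)
        (𝓝 (2 * j * T - k * T ^ 2)) :=
      (Continuous.tendsto (by fun_prop) T).mono_left nhdsWithin_le_nhds
    refine ⟨_, (h1.add h2).congr fun t => ?_⟩
    ring
  have hL0 : 0 ≤ L := ge_of_tendsto' hL (fun t => by positivity)
  rcases hL0.eq_or_lt with hL0 | hL0
  · -- collision
    rw [← hL0] at hL
    have hs := hL.sqrt
    rw [Real.sqrt_zero] at hs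
    refine Tendsto.prodMk_nhds ?_ ?_
    · refine squeeze_zero_norm (fun t => ?_) hs
      exact Real.abs_le_sqrt (by linarith [sq_nonneg (y t)])
    · refine squeeze_zero_norm (fun t => ?_) hs
      exact Real.abs_le_sqrt (by linarith [sq_nonneg (x t)])
  · -- continuation
    exfalso
    have hR : Tendsto (fun t => hillR (x t) (y t)) (𝓝[<] T) (𝓝 (√L)) := hL.sqrt
    have hRL : 0 < √L := Real.sqrt_pos.2 hL0
    have hP : Tendsto (fun t => (hillR (x t) (y t)) ^ α) (𝓝[<] T) (𝓝 ((√L) ^ α)) :=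
      hR.rpow_const (Or.inl hRL.ne')
    obtain ⟨e0, he0⟩ : ∃ e0, e0 = hillE α (x 0) (y 0) (deriv x 0) (deriv y 0) := ⟨_, rfl⟩
    have hB : Tendsto (fun t => 2 * e0 + (α + 2) * (x t ^ 2 + y t ^ 2) +
        2 * ((α + 2) / hillR (x t) (y t) ^ α)) (𝓝[<] T)
        (𝓝 (2 * e0 + (α + 2) * L + 2 * ((α + 2) / (√L) ^ α))) :=
      (tendsto_const_nhds.add (hL.const_mul _)).add
        ((tendsto_const_nhds.div hP (by positivity)).const_mul 2)
    obtain ⟨B, hBB⟩ := hB.isBoundedUnder_le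
    rw [eventually_map] at hBB
    have hv2 : ∀ᶠ t in 𝓝[<] T, deriv x t ^ 2 + deriv y t ^ 2 ≤ B := by
      filter_upwards [hBB, hev] with t ht hd
      have h1 := (hap t hd).1
      rw [← he0] at h1
      unfold hillE hillV at h1
      have : 0 ≤ (α + 2) * y t ^ 2 := mul_nonneg (by linarith) (sq_nonneg _)
      linarith
    have hvx : ∀ᶠ t in 𝓝[<] T, |deriv x t| ≤ √B := by
      filter_upwards [hv2] with t ht
      exact Real.abs_le_sqrt (by linarith [sq_nonneg (deriv y t)])
    have hvy : ∀ᶠ t in 𝓝[<] T, |deriv y t| ≤ √B := by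
      filter_upwards [hv2] with t ht
      exact Real.abs_le_sqrt (by linarith [sq_nonneg (deriv x t)])
    obtain ⟨a, ha⟩ := hh_lim T (√B) x (deriv x) (hev.mono fun t ht => (hsol t ht).2.1) hvx
    obtain ⟨b, hb⟩ := hh_lim T (√B) y (deriv y) (hev.mono fun t ht => (hsol t ht).2.2.1) hvy
    have hQ : Tendsto (fun t => (hillR (x t) (y t)) ^ (α + 2)) (𝓝[<] T) (𝓝 ((√L) ^ (α + 2))) :=
      hR.rpow_const (Or.inl hRL.ne')
    have hQne : (√L) ^ (α + 2) ≠ 0 := by positivity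
    have hVx : Tendsto (fun t => |hillVx α (x t) (y t)|) (𝓝[<] T) _ :=
      ((ha.const_mul (-(α + 2))).add ((ha.const_mul ((α + 2) * α)).div hQ hQne)).abs
    have hVy : Tendsto (fun t => |hillVy α (x t) (y t)|) (𝓝[<] T) _ :=
      ((hb.const_mul ((α + 2) * α)).div hQ hQne).abs
    obtain ⟨B1, hB1⟩ := hVx.isBoundedUnder_le
    obtain ⟨B2, hB2⟩ := hVy.isBoundedUnder_le
    rw [eventually_map] at hB1 hB2
    obtain ⟨c, hc⟩ := hh_lim T (2 * √B + B1) (deriv x) _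
      (hev.mono fun t ht => (hsol t ht).2.2.2.1) (by
        filter_upwards [hvy, hB1] with t h1 h2
        rw [abs_le] at *
        constructor <;> linarith)
    obtain ⟨d, hd⟩ := hh_lim T (2 * √B + B2) (deriv y) _
      (hev.mono fun t ht => (hsol t ht).2.2.2.2) (by
        filter_upwards [hvx, hB2] with t h1 h2
        rw [abs_le] at *
        constructor <;> linarith)
    have hab : (a, b) ≠ (0, 0) := by
      intro h
      rw [Prod.mk.injEq] at h
      have := tendsto_nhds_unique hL ((ha.pow 2).add (hb.pow 2))
      rw [h.1, h.2] at this
      norm_num at this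
      linarith
    obtain ⟨T', hT', hex⟩ := hh_extend α T hTp x y hsol a b c d hab ha hb hc hd
    exact hmax T' hT' hex
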